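/- Let $P$ be a finite index set with vectors $\psi_i \in \mathbb{R}^{K+m}$ satisfying $\sum_{i \in P}\psi_i = \mathbf{0}$, let $B$ be a real $K \times (K+m)$ matrix, set $\rho_i = -B\psi_i$, fix $a \in \mathbb{R}^K$, and for each split $(C_1, C_2)$ of $P$ define $\tilde\theta_{C_j} = a + \frac{1}{n_{C_j}}\sum_{i \in C_j}\rho_i$ and the heterogeneity criterion $\widetilde\Delta(C_1, C_2) = \frac{n_{C_1}n_{C_2}}{n_P^2}\|\tilde\theta_{C_1} - \tilde\theta_{C_2}\|^2$. Then $\frac{1}{n_P}\big(n_{C_1}\|\bar\rho_{C_1}\|^2 + n_{C_2}\|\bar\rho_{C_2}\|^2\big) = \widetilde\Delta(C_1, C_2)$; consequently, over any nonempty finite collection of candidate splits of $P$, a split minimizes the least-squares CART criterion $\sum_{j=1,2}\sum_{i \in C_j}\|\rho_i - \bar\rho_{C_j}\|^2$ on the pseudo-outcomes if and only if it maximizes $\widetilde\Delta(C_1, C_2)$. -/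

import Mathlib

/-- Mean of the vectors `ρ` over a finite index set `C`. -/
noncomputable def childMean {ι : Type*} {K : ℕ}
    (ρ : ι → EuclideanSpace ℝ (Fin K)) (C : Finset ι) : EuclideanSpace ℝ (Fin K) :=
  (C.card : ℝ)⁻¹ • ∑ i ∈ C, ρ i

/-- The least-squares CART criterion of a split `(C₁, C₂)` on the pseudo-outcomes. -/
noncomputable def cartCriterion' {ι : Type*} {K : ℕ}
    (ρ : ι → EuclideanSpace ℝ (Fin K)) (s : Finset ι × Finset ι) : ℝ :=
  (∑ i ∈ s.1, ‖ρ i - childMean ρ s.1‖ ^ 2) + ∑ i ∈ s.2, ‖ρ i - childMean ρ s.2‖ ^ 2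

/-- The heterogeneity criterion
`Δ̃(C₁,C₂) = (n_{C₁} n_{C₂} / n_P²) ‖θ̃_{C₁} - θ̃_{C₂}‖²`, where
`θ̃_{Cⱼ} = a + ρ̄_{Cⱼ}`. -/
noncomputable def hetCriterion {ι : Type*} {K : ℕ}
    (ρ : ι → EuclideanSpace ℝ (Fin K)) (a : EuclideanSpace ℝ (Fin K))
    (nP : ℕ) (s : Finset ι × Finset ι) : ℝ :=
  ((s.1.card : ℝ) * (s.2.card : ℝ) / (nP : ℝ) ^ 2) *
    ‖(a + childMean ρ s.1) - (a + childMean ρ s.2)‖ ^ 2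

theorem card_smul_childMean {ι : Type*} {K : ℕ} (ρ : ι → EuclideanSpace ℝ (Fin K))
    (C : Finset ι) : (C.card : ℝ) • childMean ρ C = ∑ i ∈ C, ρ i := by
  rcases C.eq_empty_or_nonempty with rfl | hC
  · simp
  · rw [childMean, smul_inv_smul₀ (by exact_mod_cast hC.card_ne_zero)]

theorem sum_norm_sub_childMean_sq {ι : Type*} {K : ℕ} (ρ : ι → EuclideanSpace ℝ (Fin K))
    (C : Finset ι) :
    ∑ i ∈ C, ‖ρ i - childMean ρ C‖ ^ 2 =
      ∑ i ∈ C, ‖ρ i‖ ^ 2 - (C.card : ℝ) * ‖childMean ρ C‖ ^ 2 := by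
  simp only [norm_sub_sq_real, Finset.sum_add_distrib, Finset.sum_sub_distrib,
    Finset.sum_const, nsmul_eq_mul, ← Finset.mul_sum, ← sum_inner]
  rw [← card_smul_childMean, real_inner_smul_left, real_inner_self_eq_norm_sq]
  ring

theorem weighted_norm_sq_add_of_weighted_sum_eq_zero {E : Type*} [NormedAddCommGroup E]
    [InnerProductSpace ℝ E] {p q : ℝ} (hpq : p + q ≠ 0) {x y : E} (h : p • x + q • y = 0) :
    (p + q)⁻¹ * (p * ‖x‖ ^ 2 + q * ‖y‖ ^ 2) = p * q / (p + q) ^ 2 * ‖x - y‖ ^ 2 := by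
  have hx : p * ‖x‖ ^ 2 + q * inner ℝ x y = 0 := by
    simpa [inner_add_right, real_inner_smul_right] using congrArg (inner ℝ x) h
  have hy : p * inner ℝ x y + q * ‖y‖ ^ 2 = 0 := by
    simpa [inner_add_right, real_inner_smul_right, real_inner_comm x y] using
      congrArg (inner ℝ y) h
  rw [norm_sub_sq_real]
  field_simp
  linear_combination p * hx + q * hy

theorem childMean_hetCriterion_eq {ι : Type*} [DecidableEq ι] {K : ℕ}
    {ρ : ι → EuclideanSpace ℝ (Fin K)} {P : Finset ι} (hsum : ∑ i ∈ P, ρ i = 0)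
    (a : EuclideanSpace ℝ (Fin K)) {s : Finset ι × Finset ι}
    (hd : Disjoint s.1 s.2) (hne : s.1.Nonempty) (hP : s.1 ∪ s.2 = P) :
    (P.card : ℝ)⁻¹ *
        ((s.1.card : ℝ) * ‖childMean ρ s.1‖ ^ 2 + (s.2.card : ℝ) * ‖childMean ρ s.2‖ ^ 2) =
      hetCriterion ρ a P.card s := by
  subst hP
  have hpos : (0 : ℝ) < s.1.card := by exact_mod_cast hne.card_pos
  rw [hetCriterion, add_sub_add_left_eq_sub, Finset.card_union_of_disjoint hd, Nat.cast_add]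
  refine weighted_norm_sq_add_of_weighted_sum_eq_zero (by positivity) ?_
  rw [card_smul_childMean, card_smul_childMean, ← Finset.sum_union hd, hsum]

theorem cartCriterion'_eq_sub_hetCriterion {ι : Type*} [DecidableEq ι] {K : ℕ}
    {ρ : ι → EuclideanSpace ℝ (Fin K)} {P : Finset ι} (hsum : ∑ i ∈ P, ρ i = 0)
    (a : EuclideanSpace ℝ (Fin K)) {s : Finset ι × Finset ι}
    (hd : Disjoint s.1 s.2) (hne : s.1.Nonempty) (hP : s.1 ∪ s.2 = P) :
    cartCriterion' ρ s = ∑ i ∈ P, ‖ρ i‖ ^ 2 - P.card * hetCriterion ρ a P.card s := by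
  have hcard : (P.card : ℝ) ≠ 0 := by
    exact_mod_cast (hP ▸ hne.mono Finset.subset_union_left : P.Nonempty).card_ne_zero
  rw [← childMean_hetCriterion_eq hsum a hd hne hP, mul_inv_cancel_left₀ hcard, ← hP,
    Finset.sum_union hd, cartCriterion', sum_norm_sub_childMean_sq, sum_norm_sub_childMean_sq]
  ring

/-- With zero-sum scores `ψ`, pseudo-outcomes `ρ i = -B ψ i`, and
child approximations `θ̃_{Cⱼ} = a + ρ̄_{Cⱼ}`: for every split of `P`,
`(1/n_P)(n_{C₁}‖ρ̄_{C₁}‖² + n_{C₂}‖ρ̄_{C₂}‖²) = Δ̃(C₁,C₂)`; consequently, over any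
nonempty finite collection of candidate splits of `P`, a split minimizes the
least-squares CART criterion on the pseudo-outcomes iff it maximizes `Δ̃`. -/
theorem cart_min_iff_het_max
    {ι : Type*} [DecidableEq ι] (K m : ℕ) (hK : 0 < K)
    (P : Finset ι)
    (ψ : ι → EuclideanSpace ℝ (Fin (K + m)))
    (hψ : ∑ i ∈ P, ψ i = 0)
    (B : Matrix (Fin K) (Fin (K + m)) ℝ)
    (ρ : ι → EuclideanSpace ℝ (Fin K))
    (hρ : ∀ i, ρ i = -(B.mulVec (ψ i)))
    (a : EuclideanSpace ℝ (Fin K)) :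
    (∀ s : Finset ι × Finset ι,
        Disjoint s.1 s.2 → s.1.Nonempty → s.2.Nonempty → s.1 ∪ s.2 = P →
        (P.card : ℝ)⁻¹ *
            ((s.1.card : ℝ) * ‖childMean ρ s.1‖ ^ 2 +
              (s.2.card : ℝ) * ‖childMean ρ s.2‖ ^ 2) =
          hetCriterion ρ a P.card s) ∧
      (∀ S : Finset (Finset ι × Finset ι), S.Nonempty →
        (∀ s ∈ S, Disjoint s.1 s.2 ∧ s.1.Nonempty ∧ s.2.Nonempty ∧ s.1 ∪ s.2 = P) →
        ∀ s ∈ S,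
          ((∀ t ∈ S, cartCriterion' ρ s ≤ cartCriterion' ρ t) ↔
            (∀ t ∈ S, hetCriterion ρ a P.card t ≤ hetCriterion ρ a P.card s))) := by
  have hsum : ∑ i ∈ P, ρ i = 0 := by
    ext k
    have h := congrArg (fun v => (B.mulVec (WithLp.ofLp v)) k) hψ
    simpa [hρ, WithLp.ofLp_sum, Matrix.mulVec_sum] using h
  refine ⟨fun s hd hne _ hP => childMean_hetCriterion_eq hsum a hd hne hP, ?_⟩
  intro S _ hS s hs
  refine forall₂_congr fun t ht => ?_
  obtain ⟨hds, hnes, -, hPs⟩ := hS s hs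
  obtain ⟨hdt, hnet, -, hPt⟩ := hS t ht
  have hpos : (0 : ℝ) < P.card := by
    exact_mod_cast (hPs ▸ hnes.mono Finset.subset_union_left : P.Nonempty).card_pos
  rw [cartCriterion'_eq_sub_hetCriterion hsum a hds hnes hPs,
    cartCriterion'_eq_sub_hetCriterion hsum a hdt hnet hPt, sub_le_sub_iff_left,
    mul_le_mul_iff_right₀ hpos]
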